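/- arXiv:2004.09283 — 3 statements merged into one kernel-verified Lean document; each statement's English description precedes it below -/
import Mathlib

section
/- (Theorem 2, operation count of the direct algorithm) For all natural numbers n and k with n ≥ k ≥ 1, the following identity holds in ℤ: (2n - k + 2) + ∑_{l=1}^{k} ∑_{i=l}^{n-k+l} (2(i - l) + 1) = k·n² + 2·(-k² + k + 1)·n + k³ - 2k² + 2. -/
/-- The sum of the first `m + 1` odd numbers, indexed from an arbitrary starting point `l`. -/
theorem sum_Icc_odd_eq_sq (l m : ℕ) :
    ∑ i ∈ Finset.Icc l (m + l), (2 * ((i : ℤ) - (l : ℤ)) + 1) = ((m : ℤ) + 1) ^ 2 := by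
  induction m with
  | zero => simp
  | succ m ih =>
    rw [Nat.add_right_comm, Finset.sum_Icc_succ_top (by omega), ih]
    push_cast
    ring

/-- Theorem 2: exact operation count `Q(n,k)` of the direct algorithm:
`(2n - k + 2) + ∑_{l=1}^{k} ∑_{i=l}^{n-k+l} (2(i-l)+1) = kn² + 2(-k²+k+1)n + k³ - 2k² + 2`,
as an identity in `ℤ`. -/
theorem operation_count_direct (n k : ℕ) (hk : 1 ≤ k) (hn : k ≤ n) :
    (2 * (n : ℤ) - (k : ℤ) + 2) +
      ∑ l ∈ Finset.Icc 1 k, ∑ i ∈ Finset.Icc l (n - k + l), (2 * ((i : ℤ) - (l : ℤ)) + 1) =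
    (k : ℤ) * (n : ℤ) ^ 2 + 2 * (-(k : ℤ) ^ 2 + (k : ℤ) + 1) * (n : ℤ) +
      (k : ℤ) ^ 3 - 2 * (k : ℤ) ^ 2 + 2 := by
  simp only [sum_Icc_odd_eq_sq, Finset.sum_const, Nat.card_Icc, Nat.add_sub_cancel,
    nsmul_eq_mul, Nat.cast_sub hn]
  ring
end

section
/- (Theorem 3, operation count of the factorized algorithm) Let σ ≥ 1 and let p₁, p₂, …, p_σ be natural numbers. For j = 1,…,σ set r_j = ∑_{m=1}^{σ-j+1} p_m. Then for every natural number n with n ≥ ∑_{m=1}^{σ} p_m, the following identity holds in ℤ: 2n + 2σ - ∑_{m=1}^{σ} p_m + ∑_{j=1}^{σ} ∑_{l=1}^{p_{σ-j+1}} ∑_{i=l}^{l + n + σ - j - r_j} (2(i - l) + 1) = a·n² + b·n + c, where a = ∑_{j=1}^{σ} p_j, b = 2 + 2·∑_{j=1}^{σ} (j - ∑_{m=1}^{j} p_m)·p_j, and c = ∑_{j=1}^{σ} (j - ∑_{m=1}^{j} p_m)²·p_j - ∑_{j=1}^{σ} p_j + 2σ. -/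
/-- The sum of the first `N + 1` odd numbers, with the summation index shifted by `l`. -/
theorem sum_Icc_odd_shift (l N : ℕ) :
    ∑ i ∈ Finset.Icc l (l + N), (2 * ((i : ℤ) - (l : ℤ)) + 1) = ((N : ℤ) + 1) ^ 2 := by
  induction N with
  | zero => simp
  | succ N ih =>
    rw [← add_assoc, Finset.sum_Icc_succ_top (by omega), ih]
    push_cast
    ring

/-- Reversing the order of summation over `{1, …, s}`. -/
theorem sum_Icc_one_reverse {M : Type*} [AddCommMonoid M] (s : ℕ) (f : ℕ → M) :
    ∑ j ∈ Finset.Icc 1 s, f (s - j + 1) = ∑ j ∈ Finset.Icc 1 s, f j := by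
  refine Finset.sum_nbij' (fun j => s - j + 1) (fun j => s - j + 1) ?_ ?_ ?_ ?_ fun _ _ => rfl <;>
    simp only [Finset.mem_Icc] <;> intros <;> omega


/-- Theorem 3: exact operation count `Q'(n,k)` of the factorized algorithm, as an
identity in `ℤ`: with `r_j = ∑_{m=1}^{σ-j+1} p_m` and `n ≥ ∑_{m=1}^{σ} p_m`,
`2n + 2σ - ∑ p_m + ∑_{j=1}^{σ} ∑_{l=1}^{p_{σ-j+1}} ∑_{i=l}^{l+n+σ-j-r_j} (2(i-l)+1)
  = a n² + b n + c`. -/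
theorem operation_count_factorized (σ : ℕ) (hσ : 1 ≤ σ) (p : ℕ → ℕ) (r : ℕ → ℕ)
    (hr : ∀ j, r j = ∑ m ∈ Finset.Icc 1 (σ - j + 1), p m)
    (n : ℕ) (hn : ∑ m ∈ Finset.Icc 1 σ, p m ≤ n) :
    (2 * (n : ℤ) + 2 * (σ : ℤ) - ∑ m ∈ Finset.Icc 1 σ, (p m : ℤ)) +
      ∑ j ∈ Finset.Icc 1 σ, ∑ l ∈ Finset.Icc 1 (p (σ - j + 1)),
        ∑ i ∈ Finset.Icc l (l + n + σ - j - r j), (2 * ((i : ℤ) - (l : ℤ)) + 1) =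
    (∑ j ∈ Finset.Icc 1 σ, (p j : ℤ)) * (n : ℤ) ^ 2 +
      (2 + 2 * ∑ j ∈ Finset.Icc 1 σ,
        ((j : ℤ) - ∑ m ∈ Finset.Icc 1 j, (p m : ℤ)) * (p j : ℤ)) * (n : ℤ) +
      (∑ j ∈ Finset.Icc 1 σ, ((j : ℤ) - ∑ m ∈ Finset.Icc 1 j, (p m : ℤ)) ^ 2 * (p j : ℤ) -
        ∑ j ∈ Finset.Icc 1 σ, (p j : ℤ) + 2 * (σ : ℤ)) := by
  have key : ∑ j ∈ Finset.Icc 1 σ, ∑ l ∈ Finset.Icc 1 (p (σ - j + 1)),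
        ∑ i ∈ Finset.Icc l (l + n + σ - j - r j), (2 * ((i : ℤ) - (l : ℤ)) + 1) =
      ∑ j ∈ Finset.Icc 1 σ,
        ((n : ℤ) + ((j : ℤ) - ∑ m ∈ Finset.Icc 1 j, (p m : ℤ))) ^ 2 * (p j : ℤ) := by
    rw [← sum_Icc_one_reverse σ fun j =>
      ((n : ℤ) + ((j : ℤ) - ∑ m ∈ Finset.Icc 1 j, (p m : ℤ))) ^ 2 * (p j : ℤ)]
    refine Finset.sum_congr rfl fun j hj => ?_
    rw [Finset.mem_Icc] at hj
    have hrn : r j ≤ n := by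
      rw [hr]
      exact (Finset.sum_le_sum_of_subset (Finset.Icc_subset_Icc_right (by omega))).trans hn
    have hrj : (r j : ℤ) = ∑ m ∈ Finset.Icc 1 (σ - j + 1), (p m : ℤ) := by
      rw [hr]
      push_cast
      rfl
    have hN : ((n + σ - j - r j : ℕ) : ℤ) + 1 = n + (((σ - j + 1 : ℕ) : ℤ) - r j) := by
      omega
    have hinner (l : ℕ) : ∑ i ∈ Finset.Icc l (l + n + σ - j - r j),
        (2 * ((i : ℤ) - (l : ℤ)) + 1) = (n + (((σ - j + 1 : ℕ) : ℤ) - r j)) ^ 2 := by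
      rw [show l + n + σ - j - r j = l + (n + σ - j - r j) by omega, sum_Icc_odd_shift, hN]
    rw [← hrj, Finset.sum_congr rfl fun l _ => hinner l, Finset.sum_const, Nat.card_Icc,
      Nat.add_sub_cancel, nsmul_eq_mul, mul_comm]
  have expand : ∑ j ∈ Finset.Icc 1 σ,
        ((n : ℤ) + ((j : ℤ) - ∑ m ∈ Finset.Icc 1 j, (p m : ℤ))) ^ 2 * (p j : ℤ) =
      (∑ j ∈ Finset.Icc 1 σ, (p j : ℤ)) * (n : ℤ) ^ 2 +
      2 * (∑ j ∈ Finset.Icc 1 σ,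
        ((j : ℤ) - ∑ m ∈ Finset.Icc 1 j, (p m : ℤ)) * (p j : ℤ)) * (n : ℤ) +
      ∑ j ∈ Finset.Icc 1 σ, ((j : ℤ) - ∑ m ∈ Finset.Icc 1 j, (p m : ℤ)) ^ 2 * (p j : ℤ) := by
    rw [Finset.mul_sum, Finset.sum_mul, Finset.sum_mul, ← Finset.sum_add_distrib,
      ← Finset.sum_add_distrib]
    exact Finset.sum_congr rfl fun j _ => by ring
  rw [key, expand]
  ring
end

section
/- (Optimality of the decreasing factor ordering) For a finite list p = (p₁, …, p_σ) of natural numbers with p_j ≥ 2 for every j, define Q'(n; p) = a·n² + b·n + c (an integer-valued expression), where a = ∑_{j=1}^{σ} p_j, b = 2 + 2·∑_{j=1}^{σ} (j - ∑_{m=1}^{j} p_m)·p_j, and c = ∑_{j=1}^{σ} (j - ∑_{m=1}^{j} p_m)²·p_j - ∑_{j=1}^{σ} p_j + 2σ. Suppose 1 ≤ i < σ, p_i ≥ p_{i+1}, and n is a natural number with n ≥ ∏_{j=1}^{σ} p_j. Let p' be the list obtained from p by swapping the entries in positions i and i+1. Then Q'(n; p) ≤ Q'(n; p'). -/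
/-- The integer-valued operation count `Q'(n; p) = a n² + b n + c` of the nested Bell
polynomial algorithm for the factor list `p₁, …, p_σ`, where `a = ∑_{j=1}^{σ} p_j`,
`b = 2 + 2 ∑_{j=1}^{σ} (j - ∑_{m=1}^{j} p_m) p_j` and
`c = ∑_{j=1}^{σ} (j - ∑_{m=1}^{j} p_m)² p_j - ∑_{j=1}^{σ} p_j + 2σ`. -/
def QCost (n σ : ℕ) (p : ℕ → ℕ) : ℤ :=
  (∑ j ∈ Finset.Icc 1 σ, (p j : ℤ)) * (n : ℤ) ^ 2 +
    (2 + 2 * ∑ j ∈ Finset.Icc 1 σ,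
      ((j : ℤ) - ∑ m ∈ Finset.Icc 1 j, (p m : ℤ)) * (p j : ℤ)) * (n : ℤ) +
    (∑ j ∈ Finset.Icc 1 σ, ((j : ℤ) - ∑ m ∈ Finset.Icc 1 j, (p m : ℤ)) ^ 2 * (p j : ℤ) -
      ∑ j ∈ Finset.Icc 1 σ, (p j : ℤ) + 2 * (σ : ℤ))

theorem QCost_succ (n s : ℕ) (p : ℕ → ℕ) :
    QCost n (s + 1) p = QCost n s p +
      (p (s + 1) : ℤ) * ((n : ℤ) + (s + 1) - ∑ m ∈ Finset.Icc 1 (s + 1), (p m : ℤ)) ^ 2 -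
        p (s + 1) + 2 := by
  unfold QCost
  simp only [Finset.sum_Icc_succ_top (Nat.le_add_left 1 s)]
  push_cast
  ring

theorem sum_Icc_congr_of_le {p q : ℕ → ℕ} {s j : ℕ} (h : ∀ m ≤ s, q m = p m) (hj : j ≤ s) :
    ∑ m ∈ Finset.Icc 1 j, (q m : ℤ) = ∑ m ∈ Finset.Icc 1 j, (p m : ℤ) :=
  Finset.sum_congr rfl fun m hm => by rw [h m ((Finset.mem_Icc.mp hm).2.trans hj)]

theorem QCost_congr (n s : ℕ) {p q : ℕ → ℕ} (h : ∀ m ≤ s, q m = p m) :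
    QCost n s q = QCost n s p := by
  induction s with
  | zero => simp [QCost]
  | succ s ih =>
    rw [QCost_succ, QCost_succ, ih fun m hm => h m (hm.trans s.le_succ), h _ le_rfl,
      sum_Icc_congr_of_le h le_rfl]

/-- Swapping the adjacent factors `p (k + 1)` and `p (k + 2)` leaves the partial sums from
index `k + 2` on unchanged. -/
theorem sum_Icc_swap {p q : ℕ → ℕ} {k s : ℕ} (hlt : ∀ m ≤ k, q m = p m)
    (h₁ : q (k + 1) = p (k + 2)) (h₂ : q (k + 2) = p (k + 1))
    (hgt : ∀ m, k + 2 < m → q m = p m) (hs : k + 2 ≤ s) :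
    ∑ m ∈ Finset.Icc 1 s, (q m : ℤ) = ∑ m ∈ Finset.Icc 1 s, (p m : ℤ) := by
  induction s, hs using Nat.le_induction with
  | base =>
    simp only [Finset.sum_Icc_succ_top (Nat.le_add_left 1 _), h₁, h₂,
      sum_Icc_congr_of_le hlt le_rfl]
    ring
  | succ s hs ih =>
    rw [Finset.sum_Icc_succ_top (Nat.le_add_left 1 s),
      Finset.sum_Icc_succ_top (Nat.le_add_left 1 s), ih, hgt _ (by omega)]

/-- The exact change of the operation count under a swap of adjacent factors. -/
theorem QCost_swap (n : ℕ) {p q : ℕ → ℕ} {k s : ℕ} (hlt : ∀ m ≤ k, q m = p m)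
    (h₁ : q (k + 1) = p (k + 2)) (h₂ : q (k + 2) = p (k + 1))
    (hgt : ∀ m, k + 2 < m → q m = p m) (hs : k + 2 ≤ s) :
    QCost n s q = QCost n s p + ((p (k + 1) : ℤ) - p (k + 2)) *
      (2 * ((n : ℤ) + (k + 1) - ∑ m ∈ Finset.Icc 1 (k + 2), (p m : ℤ)) + 1 +
        p (k + 1) * p (k + 2)) := by
  induction s, hs using Nat.le_induction with
  | base =>
    simp only [QCost_succ, Finset.sum_Icc_succ_top (Nat.le_add_left 1 _), h₁, h₂,
      sum_Icc_congr_of_le hlt le_rfl, QCost_congr n k hlt]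
    push_cast
    ring
  | succ s hs ih =>
    rw [QCost_succ, QCost_succ, ih, hgt (s + 1) (by omega),
      sum_Icc_swap hlt h₁ h₂ hgt (hs.trans s.le_succ)]
    ring

theorem sum_Icc_le_prod_Icc {p : ℕ → ℕ} {s : ℕ} (hp : ∀ j ∈ Finset.Icc 1 (s + 1), 2 ≤ p j) :
    ∑ j ∈ Finset.Icc 1 (s + 1), p j ≤ ∏ j ∈ Finset.Icc 1 (s + 1), p j := by
  induction s with
  | zero => simp
  | succ s ih =>
    have hp' : ∀ j ∈ Finset.Icc 1 (s + 1), 2 ≤ p j := fun j hj =>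
      hp j (Finset.Icc_subset_Icc_right (Nat.le_succ _) hj)
    have hlast : 2 ≤ p (s + 1 + 1) := hp _ (by simp)
    have hfirst : 2 ≤ ∑ j ∈ Finset.Icc 1 (s + 1), p j :=
      (hp' 1 (by simp)).trans
        (Finset.single_le_sum (f := p) (fun _ _ => Nat.zero_le _) (by simp))
    rw [Finset.sum_Icc_succ_top (Nat.le_add_left 1 _),
      Finset.prod_Icc_succ_top (Nat.le_add_left 1 _)]
    nlinarith [ih hp']

/-- Optimality of the non-increasing factor ordering: swapping two adjacent factors
`p_i ≥ p_{i+1}` so that the smaller one comes first never decreases the operation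
count, provided `n ≥ ∏_{j=1}^{σ} p_j`. -/
theorem swap_not_better (σ : ℕ) (p : ℕ → ℕ) (hp : ∀ j ∈ Finset.Icc 1 σ, 2 ≤ p j)
    (i : ℕ) (hi1 : 1 ≤ i) (hi2 : i < σ) (hswap : p (i + 1) ≤ p i)
    (n : ℕ) (hn : ∏ j ∈ Finset.Icc 1 σ, p j ≤ n)
    (p' : ℕ → ℕ)
    (hp' : ∀ j, p' j = if j = i then p (i + 1) else if j = i + 1 then p i else p j) :
    QCost n σ p ≤ QCost n σ p' := by
  obtain ⟨k, rfl⟩ := Nat.exists_eq_add_of_le' hi1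
  rw [QCost_swap (p := p) (q := p') n (fun m hm => by rw [hp', if_neg (by omega), if_neg (by omega)])
    (by simp [hp']) (by simp [hp'])
    (fun m hm => by rw [hp', if_neg (by omega), if_neg (by omega)]) hi2]
  have hsub : Finset.Icc 1 (k + 1 + 1) ⊆ Finset.Icc 1 σ := Finset.Icc_subset_Icc_right hi2
  have hsum : ∑ j ∈ Finset.Icc 1 (k + 2), p j ≤ n :=
    (sum_Icc_le_prod_Icc fun j hj => hp j (hsub hj)).trans <|
      (Finset.prod_le_prod_of_subset_of_one_le' hsub fun j hj _ =>
        one_le_two.trans (hp j hj)).trans hn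
  have hsum' : ∑ j ∈ Finset.Icc 1 (k + 2), (p j : ℤ) ≤ n := by exact_mod_cast hsum
  have hdiff : (0 : ℤ) ≤ (p (k + 1) : ℤ) - p (k + 2) := sub_nonneg.mpr (by exact_mod_cast hswap)
  have hprod : (0 : ℤ) ≤ (p (k + 1) : ℤ) * p (k + 2) := by positivity
  exact le_add_of_nonneg_right (mul_nonneg hdiff (by linarith))
end
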